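/- Let X be a real Banach space and J ⊆ X a proper M-ideal (an M-ideal that is not an M-summand) such that the quotient X/J is not reflexive. If x₀ ∈ S_X is a Namioka point of S_X (i.e. the canonical image of x₀ in X** is a Namioka point of B_{X**}), then dist(x₀, J) = 1; in particular, ‖π(x₀)‖ = 1 where π : X → X/J is the quotient map, π(x₀) is a Namioka point of S_{X/J}, and J contains no Namioka points of S_X. -/

import Mathlib

/-!
STATEMENT 10: Let `J ⊆ X` be a proper M-ideal (an M-ideal that is not an M-summand)
such that `X/J` is not reflexive. If `x₀ ∈ S_X` is a Namioka point of `S_X` (its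
canonical image in `X**` is a Namioka point of `B_{X**}`), then `dist(x₀, J) = 1`;
in particular `‖π(x₀)‖ = 1`, `π(x₀)` is a Namioka point of `S_{X/J}`, and `J` contains
no Namioka points of `S_X`.
-/

noncomputable section

open NormedSpace

/-- The weak* topology `σ(Z*, Z)` on the dual of a normed space `Z`. -/
def weakStarTop (Z : Type*) [SeminormedAddCommGroup Z] [NormedSpace ℝ Z] :
    TopologicalSpace (Z →L[ℝ] ℝ) :=
  ⨅ z : Z, TopologicalSpace.induced (fun φ : Z →L[ℝ] ℝ => φ z) inferInstance

/-- The weak topology `σ(Z, Z*)` on a normed space `Z`. -/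
def weakTop (Z : Type*) [SeminormedAddCommGroup Z] [NormedSpace ℝ Z] :
    TopologicalSpace Z :=
  ⨅ f : Z →L[ℝ] ℝ, TopologicalSpace.induced (fun z : Z => f z) inferInstance

/-- `z₀` is a Namioka point of the dual unit ball `B_{Z*}`: the identity map from
`(B_{Z*}, σ(Z*,Z))` to `(B_{Z*}, σ(Z*,Z**))` is continuous at `z₀`. -/
def IsNamiokaPoint (Z : Type*) [SeminormedAddCommGroup Z] [NormedSpace ℝ Z]
    (z₀ : Z →L[ℝ] ℝ) : Prop :=
  @ContinuousWithinAt (Z →L[ℝ] ℝ) (Z →L[ℝ] ℝ) (weakStarTop Z) (weakTop (Z →L[ℝ] ℝ))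
    id {φ : Z →L[ℝ] ℝ | ‖φ‖ ≤ 1} z₀

/-- `J` is an M-ideal in `Z`: there is a bounded linear projection `P : Z* → Z*` with
kernel `J^⊥` such that `‖f‖ = ‖P f‖ + ‖f − P f‖` for all `f ∈ Z*`. -/
def IsMIdeal (Z : Type*) [SeminormedAddCommGroup Z] [NormedSpace ℝ Z]
    (J : Submodule ℝ Z) : Prop :=
  ∃ P : (Z →L[ℝ] ℝ) →L[ℝ] (Z →L[ℝ] ℝ),
    P.comp P = P ∧
    (∀ f : Z →L[ℝ] ℝ, P f = 0 ↔ ∀ z ∈ J, f z = 0) ∧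
    ∀ f : Z →L[ℝ] ℝ, ‖f‖ = ‖P f‖ + ‖f - P f‖

/-- `J` is an M-summand in `Z`: there is a bounded linear projection `Q : Z → Z` with
range `J` such that `‖z‖ = max ‖Q z‖ ‖z − Q z‖` for all `z ∈ Z`. -/
def IsMSummand (Z : Type*) [SeminormedAddCommGroup Z] [NormedSpace ℝ Z]
    (J : Submodule ℝ Z) : Prop :=
  ∃ Q : Z →L[ℝ] Z, Q.comp Q = Q ∧ Set.range Q = (J : Set Z) ∧
    ∀ z : Z, ‖z‖ = max ‖Q z‖ ‖z - Q z‖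

open Filter Topology

theorem nhdsWithin_weakStarTop (Z : Type*) [SeminormedAddCommGroup Z] [NormedSpace ℝ Z]
    (z₀ : Z →L[ℝ] ℝ) (s : Set (Z →L[ℝ] ℝ)) :
    @nhdsWithin _ (weakStarTop Z) z₀ s =
      (⨅ z : Z, comap (fun φ : Z →L[ℝ] ℝ => φ z) (𝓝 (z₀ z))) ⊓ 𝓟 s := by
  unfold nhdsWithin weakStarTop
  rw [nhds_iInf]
  simp only [nhds_induced]

theorem isNamiokaPoint_iff (Z : Type*) [SeminormedAddCommGroup Z] [NormedSpace ℝ Z]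
    (z₀ : Z →L[ℝ] ℝ) :
    IsNamiokaPoint Z z₀ ↔ ∀ Φ : (Z →L[ℝ] ℝ) →L[ℝ] ℝ,
      Tendsto Φ ((⨅ z : Z, comap (fun φ : Z →L[ℝ] ℝ => φ z) (𝓝 (z₀ z))) ⊓
        𝓟 {φ : Z →L[ℝ] ℝ | ‖φ‖ ≤ 1}) (𝓝 (Φ z₀)) := by
  unfold IsNamiokaPoint ContinuousWithinAt
  rw [nhdsWithin_weakStarTop]
  unfold weakTop
  rw [nhds_iInf, tendsto_iInf]
  simp only [nhds_induced, tendsto_comap_iff]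
  rfl

/-- A norm-continuous functional is almost constant on the points of the ball which agree with a
Namioka point on a suitable finite set. -/
theorem IsNamiokaPoint.exists_finite {Z : Type*} [SeminormedAddCommGroup Z] [NormedSpace ℝ Z]
    {z₀ : Z →L[ℝ] ℝ} (h : IsNamiokaPoint Z z₀) (Φ : (Z →L[ℝ] ℝ) →L[ℝ] ℝ) {ε : ℝ} (hε : 0 < ε) :
    ∃ s : Finset Z, ∀ φ : Z →L[ℝ] ℝ, ‖φ‖ ≤ 1 → (∀ z ∈ s, φ z = z₀ z) → |Φ φ - Φ z₀| < ε := by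
  have h1 := (isNamiokaPoint_iff Z z₀).1 h Φ (Metric.ball_mem_nhds _ hε)
  rw [mem_map, mem_inf_principal, mem_iInf_finite] at h1
  obtain ⟨s, hs⟩ := h1
  refine ⟨s, fun φ hφ hz => ?_⟩
  have hle : pure φ ≤ ⨅ z ∈ s, comap (fun φ : Z →L[ℝ] ℝ => φ z) (𝓝 (z₀ z)) := by
    refine le_iInf₂ fun z hzs => ?_
    rw [← map_le_iff_le_comap, map_pure, hz z hzs]
    exact pure_le_nhds _
  have := (hle hs : _) hφ
  simpa [Real.dist_eq] using this

/-- Namioka points pass to affine retracts of dual balls. -/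
theorem IsNamiokaPoint.of_retract {Y Z : Type*} [SeminormedAddCommGroup Y] [NormedSpace ℝ Y]
    [SeminormedAddCommGroup Z] [NormedSpace ℝ Z] {z₀ : Z →L[ℝ] ℝ} {y₀ : Y →L[ℝ] ℝ}
    (h : IsNamiokaPoint Z z₀) (A : (Y →L[ℝ] ℝ) → (Z →L[ℝ] ℝ))
    (R : (Z →L[ℝ] ℝ) →L[ℝ] (Y →L[ℝ] ℝ)) (hRA : ∀ ξ, R (A ξ) = ξ)
    (hball : ∀ ξ, ‖ξ‖ ≤ 1 → ‖A ξ‖ ≤ 1) (c : Z → ℝ) (t : Z → Y)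
    (hA : ∀ ξ z, A ξ z = c z + ξ (t z)) (hA₀ : A y₀ = z₀) : IsNamiokaPoint Y y₀ := by
  rw [isNamiokaPoint_iff] at h ⊢
  intro Φ
  have h1 := h (Φ.comp R)
  have h2 : Tendsto A ((⨅ y : Y, comap (fun φ : Y →L[ℝ] ℝ => φ y) (𝓝 (y₀ y))) ⊓
        𝓟 {φ : Y →L[ℝ] ℝ | ‖φ‖ ≤ 1}) ((⨅ z : Z, comap (fun φ : Z →L[ℝ] ℝ => φ z) (𝓝 (z₀ z))) ⊓
        𝓟 {φ : Z →L[ℝ] ℝ | ‖φ‖ ≤ 1}) := by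
    refine tendsto_inf.2 ⟨tendsto_iInf.2 fun z => tendsto_comap_iff.2 ?_,
      tendsto_principal.2 (mem_inf_of_right hball)⟩
    have h3 : Tendsto (fun ξ : Y →L[ℝ] ℝ => ξ (t z))
        ((⨅ y : Y, comap (fun φ : Y →L[ℝ] ℝ => φ y) (𝓝 (y₀ y))) ⊓
          𝓟 {φ : Y →L[ℝ] ℝ | ‖φ‖ ≤ 1}) (𝓝 (y₀ (t z))) :=
      (map_mono (inf_le_left.trans (iInf_le _ (t z)))).trans map_comap_le
    rw [← hA₀, hA]
    exact (h3.const_add (c z)).congr fun ξ => (hA ξ z).symm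
  have h4 := h1.comp h2
  rw [← hA₀] at h4
  simpa [Function.comp_def, hRA] using h4

/-- If an interior point of `B_{Z*}` is a Namioka point, then every functional on `Z*` is
a uniform limit of evaluations. -/
theorem IsNamiokaPoint.exists_norm_sub_le {Z : Type*} [SeminormedAddCommGroup Z]
    [NormedSpace ℝ Z] {z₀ : Z →L[ℝ] ℝ} (h : IsNamiokaPoint Z z₀) (hz₀ : ‖z₀‖ < 1)
    (Φ : (Z →L[ℝ] ℝ) →L[ℝ] ℝ) {ε : ℝ} (hε : 0 < ε) :
    ∃ f : Z, ‖Φ - inclusionInDoubleDual ℝ Z f‖ ≤ ε := by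
  set r : ℝ := 1 - ‖z₀‖ with hr
  have hr0 : 0 < r := by linarith
  obtain ⟨s, hs⟩ := h.exists_finite Φ (mul_pos hε hr0)
  let K : Submodule ℝ (Z →L[ℝ] ℝ) :=
    ⨅ z : s, LinearMap.ker (inclusionInDoubleDual ℝ Z z : (Z →L[ℝ] ℝ) →ₗ[ℝ] ℝ)
  have hK : ∀ ξ, ξ ∈ K ↔ ∀ z ∈ s, ξ z = 0 := by
    intro ξ
    simp [K, Submodule.mem_iInf]
  have hbound : ∀ ξ ∈ K, ‖Φ ξ‖ ≤ ε * ‖ξ‖ := by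
    have hsmall : ∀ ξ ∈ K, ‖ξ‖ ≤ r → |Φ ξ| ≤ ε * r := by
      intro ξ hξ hξr
      have := hs (z₀ + ξ) ((norm_add_le _ _).trans (by linarith)) fun z hz => by
        simp [(hK ξ).1 hξ z hz]
      simpa using this.le
    intro ξ hξ
    rcases (norm_nonneg ξ).eq_or_lt with h0 | hpos
    · simpa [← h0] using Φ.le_opNorm ξ
    have h1 := hsmall ((r / ‖ξ‖) • ξ) (K.smul_mem _ hξ) (by
      rw [norm_smul, Real.norm_of_nonneg (by positivity), div_mul_cancel₀ _ hpos.ne'])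
    rw [map_smul, smul_eq_mul, abs_mul, abs_of_nonneg (by positivity), div_mul_eq_mul_div,
      div_le_iff₀ hpos] at h1
    rw [Real.norm_eq_abs]
    nlinarith
  obtain ⟨Ψ, hΨ, hΨn⟩ := _root_.exists_extension_norm_eq K (Φ.comp K.subtypeL)
  have hmem : ((Φ - Ψ : (Z →L[ℝ] ℝ) →L[ℝ] ℝ) : (Z →L[ℝ] ℝ) →ₗ[ℝ] ℝ) ∈
      Submodule.span ℝ (Set.range fun z : s =>
        (inclusionInDoubleDual ℝ Z z : (Z →L[ℝ] ℝ) →ₗ[ℝ] ℝ)) := by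
    refine mem_span_of_iInf_ker_le_ker fun ξ hξ => ?_
    have := hΨ ⟨ξ, hξ⟩
    simp at this
    simp [this]
  obtain ⟨a, ha⟩ := (Submodule.mem_span_range_iff_exists_fun ℝ).1 hmem
  refine ⟨∑ z : s, a z • (z : Z), ?_⟩
  have heq : Φ - inclusionInDoubleDual ℝ Z (∑ z : s, a z • (z : Z)) = Ψ := by
    ext ξ
    have := LinearMap.congr_fun ha ξ
    simp at this
    simp [this]
  rw [heq, hΨn]
  refine ContinuousLinearMap.opNorm_le_bound _ hε.le fun ξ => ?_
  exact hbound ξ ξ.2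

set_option maxSynthPendingDepth 3 in
/-- If an interior point of the bidual ball of a complete space is a Namioka point, then the space
is reflexive. -/
theorem IsNamiokaPoint.surjective_inclusionInDoubleDual {Y : Type*} [SeminormedAddCommGroup Y]
    [NormedSpace ℝ Y] [CompleteSpace Y] {y₀ : (Y →L[ℝ] ℝ) →L[ℝ] ℝ}
    (h : IsNamiokaPoint (Y →L[ℝ] ℝ) y₀) (hy₀ : ‖y₀‖ < 1) :
    Function.Surjective (inclusionInDoubleDual ℝ Y) := by
  let M : Submodule ℝ ((Y →L[ℝ] ℝ) →L[ℝ] ℝ) :=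
    LinearMap.range (inclusionInDoubleDualLi ℝ (E := Y)).toLinearMap
  have hM : IsClosed (M : Set ((Y →L[ℝ] ℝ) →L[ℝ] ℝ)) := by
    have : IsComplete (Set.range (inclusionInDoubleDualLi ℝ (E := Y))) :=
      (inclusionInDoubleDualLi ℝ (E := Y)).isometry.isUniformInducing.isComplete_range
    exact this.isClosed
  intro ψ
  by_contra hψ
  have hψM : ψ ∉ (M : Set ((Y →L[ℝ] ℝ) →L[ℝ] ℝ)) := hψ
  obtain ⟨Φ, u, hu, huψ⟩ : ∃ Φ : ((Y →L[ℝ] ℝ) →L[ℝ] ℝ) →L[ℝ] ℝ, ∃ u : ℝ,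
      (∀ m ∈ M, Φ m < u) ∧ u < Φ ψ :=
    geometric_hahn_banach_closed_point M.convex hM hψM
  have hΦM : ∀ m ∈ M, Φ m = 0 := by
    intro m hm
    by_contra hne
    have := hu ((u / Φ m) • m) (M.smul_mem _ hm)
    rw [map_smul, smul_eq_mul, div_mul_cancel₀ _ hne] at this
    exact lt_irrefl _ this
  have hΦ : ‖Φ‖ ≤ 0 := by
    refine le_of_forall_pos_le_add fun ε hε => ?_
    obtain ⟨f, hf⟩ := h.exists_norm_sub_le hy₀ Φ (half_pos hε)
    have hfn : ‖f‖ ≤ ε / 2 := by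
      refine ContinuousLinearMap.opNorm_le_bound _ (half_pos hε).le fun y => ?_
      have h1 := (Φ - inclusionInDoubleDual ℝ (Y →L[ℝ] ℝ) f).le_of_opNorm_le hf
        (inclusionInDoubleDual ℝ Y y)
      have h2 : Φ (inclusionInDoubleDual ℝ Y y) = 0 := hΦM _ ⟨y, rfl⟩
      rw [sub_apply, h2, zero_sub, norm_neg, dual_def, dual_def] at h1
      exact h1.trans (mul_le_mul_of_nonneg_left (double_dual_bound ℝ Y y) (half_pos hε).le)
    have h3 := norm_sub_norm_le Φ (inclusionInDoubleDual ℝ (Y →L[ℝ] ℝ) f)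
    have h4 := double_dual_bound ℝ (Y →L[ℝ] ℝ) f
    linarith
  have h0 := hu 0 M.zero_mem
  rw [map_zero] at h0
  have h1 := Φ.le_of_opNorm_le hΦ ψ
  rw [zero_mul] at h1
  linarith [Real.le_norm_self (Φ ψ)]

/-- A functional vanishing on `J` factors through `X ⧸ J` without increasing its norm. -/
theorem exists_factor_mkQ {X : Type*} [SeminormedAddCommGroup X] [NormedSpace ℝ X]
    (J : Submodule ℝ X) (g : X →L[ℝ] ℝ) (hg : ∀ x ∈ J, g x = 0) :
    ∃ q : (X ⧸ J) →L[ℝ] ℝ, (∀ x, q (J.mkQ x) = g x) ∧ ‖q‖ ≤ ‖g‖ := by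
  let q₀ : (X ⧸ J) →ₗ[ℝ] ℝ := J.liftQ (g : X →ₗ[ℝ] ℝ) fun x hx => hg x hx
  have hq₀ : ∀ x, q₀ (J.mkQ x) = g x := fun x => rfl
  have hb : ∀ y, ‖q₀ y‖ ≤ ‖g‖ * ‖y‖ := by
    intro y
    refine le_of_forall_pos_le_add fun ε hε => ?_
    have hδ : 0 < ε / (‖g‖ + 1) := by positivity
    obtain ⟨x, rfl, hx⟩ := Submodule.Quotient.norm_mk_lt y hδ
    have h1 : ‖g x‖ ≤ ‖g‖ * ‖x‖ := g.le_opNorm x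
    have h2 : ‖g‖ * ‖x‖ ≤ ‖g‖ * (‖(Submodule.Quotient.mk x : X ⧸ J)‖ + ε / (‖g‖ + 1)) :=
      mul_le_mul_of_nonneg_left hx.le (norm_nonneg _)
    have h3 : ‖g‖ * (ε / (‖g‖ + 1)) ≤ ε := by
      rw [mul_div_assoc', div_le_iff₀ (by positivity)]
      nlinarith [norm_nonneg g]
    calc ‖q₀ (Submodule.Quotient.mk x)‖ = ‖g x‖ := rfl
      _ ≤ _ := by linarith
  exact ⟨q₀.mkContinuous ‖g‖ hb, hq₀, q₀.mkContinuous_norm_le (norm_nonneg _) hb⟩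

set_option maxSynthPendingDepth 3 in
/-- The quotient map by an M-ideal sends Namioka points to Namioka points. -/
theorem IsMIdeal.isNamiokaPoint_mkQ {X : Type*} [SeminormedAddCommGroup X] [NormedSpace ℝ X]
    {J : Submodule ℝ X} (hM : IsMIdeal X J) {x₀ : X} (hx₀ : ‖x₀‖ ≤ 1)
    (h : IsNamiokaPoint (X →L[ℝ] ℝ) (inclusionInDoubleDual ℝ X x₀)) :
    IsNamiokaPoint ((X ⧸ J) →L[ℝ] ℝ) (inclusionInDoubleDual ℝ (X ⧸ J) (J.mkQ x₀)) := by
  obtain ⟨P, hPP, hker, hnorm⟩ := hM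
  have hvanish : ∀ f : X →L[ℝ] ℝ, ∀ x ∈ J, (f - P f) x = 0 := by
    intro f
    rw [← hker, map_sub, sub_eq_zero]
    exact (DFunLike.congr_fun hPP f).symm
  choose t ht htn using fun f => exists_factor_mkQ J (f - P f) (hvanish f)
  have hext : ∀ p q : (X ⧸ J) →L[ℝ] ℝ, (∀ x, p (J.mkQ x) = q (J.mkQ x)) → p = q := by
    intro p q hpq
    ext y
    obtain ⟨x, rfl⟩ := J.mkQ_surjective y
    exact hpq x
  let T₀ : (X →L[ℝ] ℝ) →ₗ[ℝ] ((X ⧸ J) →L[ℝ] ℝ) :=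
    { toFun := t
      map_add' := fun f g => hext _ _ fun x => by
        simp only [add_apply, ht, sub_apply, map_add]
        ring
      map_smul' := fun a f => hext _ _ fun x => by
        simp only [smul_apply, ht, sub_apply, map_smul,
          RingHom.id_apply, smul_eq_mul]
        ring }
  have hT₀ : ∀ f, ‖T₀ f‖ ≤ 1 * ‖f‖ := fun f => by
    have h1 := hnorm f
    have h2 := norm_nonneg (P f)
    have h3 : ‖T₀ f‖ ≤ ‖f - P f‖ := htn f
    rw [one_mul]
    linarith
  let T : (X →L[ℝ] ℝ) →L[ℝ] ((X ⧸ J) →L[ℝ] ℝ) := T₀.mkContinuous 1 hT₀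
  let π : X →L[ℝ] (X ⧸ J) := J.mkQ.mkContinuous 1 fun x => by
    simpa using Submodule.Quotient.norm_mk_le J x
  have hπ : ∀ x, π x = J.mkQ x := fun x => rfl
  let D : ((X ⧸ J) →L[ℝ] ℝ) →L[ℝ] (X →L[ℝ] ℝ) := (ContinuousLinearMap.compL ℝ X (X ⧸ J) ℝ).flip π
  have hD : ∀ q x, D q x = q (J.mkQ x) := fun q x => rfl
  have hPD : ∀ q, P (D q) = 0 := by
    intro q
    rw [hker]
    intro x hx
    rw [hD, J.mkQ_apply, (Submodule.Quotient.mk_eq_zero J).2 hx, map_zero]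
  have htD : ∀ q, t (D q) = q := fun q => hext _ _ fun x => by
    rw [ht, hPD, sub_zero, hD]
  let R : ((X →L[ℝ] ℝ) →L[ℝ] ℝ) →L[ℝ] (((X ⧸ J) →L[ℝ] ℝ) →L[ℝ] ℝ) :=
    (ContinuousLinearMap.compL ℝ _ _ ℝ).flip D
  have hR : ∀ F q, R F q = F (D q) := fun F q => rfl
  let A : (((X ⧸ J) →L[ℝ] ℝ) →L[ℝ] ℝ) → ((X →L[ℝ] ℝ) →L[ℝ] ℝ) := fun ξ =>
    (inclusionInDoubleDual ℝ X x₀).comp P + ξ.comp T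
  have hA : ∀ ξ f, A ξ f = P f x₀ + ξ (t f) := fun ξ f => rfl
  refine h.of_retract A R (fun ξ => ?_) (fun ξ hξ => ?_) (fun f => P f x₀) t hA ?_
  · ext q
    rw [hR, hA, hPD, htD]
    simp
  · refine ContinuousLinearMap.opNorm_le_bound _ zero_le_one fun f => ?_
    rw [hA, one_mul, hnorm f]
    refine (norm_add_le _ _).trans (add_le_add ?_ ?_)
    · exact (P f).unit_le_opNorm _ hx₀
    · have := ξ.le_of_opNorm_le hξ (t f)
      rw [one_mul] at this
      exact this.trans (htn f)
  · ext f
    rw [hA, dual_def, dual_def, ht]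
    simp

theorem stmt10 (X : Type*) [NormedAddCommGroup X] [NormedSpace ℝ X] [CompleteSpace X]
    (J : Submodule ℝ X) (hJclosed : IsClosed (J : Set X))
    (hM : IsMIdeal X J) (hproper : ¬ IsMSummand X J)
    -- `X/J` is not reflexive:
    (hnonrefl : ¬ Function.Surjective (inclusionInDoubleDual ℝ (X ⧸ J)))
    (x₀ : X) (hx₀ : ‖x₀‖ = 1)
    (hNam : IsNamiokaPoint (X →L[ℝ] ℝ) (inclusionInDoubleDual ℝ X x₀)) :
    Metric.infDist x₀ (J : Set X) = 1 ∧
    ‖J.mkQ x₀‖ = 1 ∧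
    IsNamiokaPoint ((X ⧸ J) →L[ℝ] ℝ)
      (inclusionInDoubleDual ℝ (X ⧸ J) (J.mkQ x₀)) ∧
    x₀ ∉ J := by
  have hN := hM.isNamiokaPoint_mkQ hx₀.le hNam
  have hle : ‖J.mkQ x₀‖ ≤ 1 := (Submodule.Quotient.norm_mk_le J x₀).trans hx₀.le
  have hnorm : ‖J.mkQ x₀‖ = 1 := by
    by_contra hne
    refine hnonrefl (hN.surjective_inclusionInDoubleDual ?_)
    exact (double_dual_bound ℝ _ _).trans_lt (lt_of_le_of_ne hle hne)
  refine ⟨?_, hnorm, hN, fun hx => ?_⟩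
  · rw [← hnorm]
    exact (QuotientAddGroup.norm_mk (S := J.toAddSubgroup) x₀).symm
  · rw [J.mkQ_apply, (Submodule.Quotient.mk_eq_zero J).2 hx, norm_zero] at hnorm
    exact zero_ne_one hnorm

end
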